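/- arXiv:1812.07803 — 4 statements merged into one kernel-verified Lean document; each statement's English description precedes it below -/
import Mathlib

section
/- For all x > 0 and y > 0, writing d_± = d_±(x,y), the second-order partial derivatives of the Black–Scholes put value are: ∂_{xx} Put_BS(x,y) = e^{−R_f}·φ(d_+)/(x√y); ∂_{yy} Put_BS(x,y) = x·e^{−R_f}·φ(d_+)·(d_− d_+ − 1)/(4 y^{3/2}); and ∂_{xy} Put_BS(x,y) = − e^{−R_f}·φ(d_+)·d_− /(2y). -/
open Real MeasureTheory Filter

/-- The standard normal cumulative distribution function Φ. -/
noncomputable def stdNormalCDF (x : ℝ) : ℝ :=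
  ∫ t in Set.Iic x, (Real.sqrt (2 * Real.pi))⁻¹ * Real.exp (-t ^ 2 / 2)

/-- The standard normal density φ(z) = (2π)^{−1/2} e^{−z²/2}. -/
noncomputable def stdNormalPDF (z : ℝ) : ℝ :=
  (Real.sqrt (2 * Real.pi))⁻¹ * Real.exp (-z ^ 2 / 2)

/-- d₊(x,y) = (ln(x/K) + R_d − R_f)/√y + √y/2. -/
noncomputable def dplus (K Rd Rf x y : ℝ) : ℝ :=
  (Real.log (x / K) + Rd - Rf) / Real.sqrt y + Real.sqrt y / 2

/-- d₋(x,y) = (ln(x/K) + R_d − R_f)/√y − √y/2. -/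
noncomputable def dminus (K Rd Rf x y : ℝ) : ℝ :=
  (Real.log (x / K) + Rd - Rf) / Real.sqrt y - Real.sqrt y / 2

/-- The Black–Scholes put value Put_BS(x,y). -/
noncomputable def PutBS (K Rd Rf x y : ℝ) : ℝ :=
  K * Real.exp (-Rd) * stdNormalCDF (-(dminus K Rd Rf x y))
    - x * Real.exp (-Rf) * stdNormalCDF (-(dplus K Rd Rf x y))

theorem integrable_stdNormalPDF : Integrable stdNormalPDF := by
  have h := (integrable_exp_neg_mul_sq (b := 1 / 2) (by norm_num)).const_mul
    (Real.sqrt (2 * Real.pi))⁻¹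
  refine h.congr (Eventually.of_forall fun t => ?_)
  simp only [stdNormalPDF]
  ring_nf

theorem continuous_stdNormalPDF : Continuous stdNormalPDF := by
  unfold stdNormalPDF
  fun_prop

theorem stdNormalPDF_neg (z : ℝ) : stdNormalPDF (-z) = stdNormalPDF z := by
  simp [stdNormalPDF]

theorem hasDerivAt_stdNormalPDF (z : ℝ) :
    HasDerivAt stdNormalPDF (-z * stdNormalPDF z) z := by
  have h : HasDerivAt (fun t : ℝ => -t ^ 2 / 2) (-z) z := by
    refine HasDerivAt.congr_deriv (((hasDerivAt_pow 2 z).neg.div_const 2)) ?_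
    norm_num
    ring
  refine HasDerivAt.congr_deriv (h.exp.const_mul (Real.sqrt (2 * Real.pi))⁻¹) ?_
  simp only [stdNormalPDF]
  ring

theorem hasDerivAt_stdNormalCDF (z : ℝ) :
    HasDerivAt stdNormalCDF (stdNormalPDF z) z := by
  have h : stdNormalCDF = fun x => stdNormalCDF 0 + ∫ t in (0 : ℝ)..x, stdNormalPDF t := by
    funext x
    have := intervalIntegral.integral_Iic_sub_Iic
      (integrable_stdNormalPDF.integrableOn (s := Set.Iic 0))
      (integrable_stdNormalPDF.integrableOn (s := Set.Iic x))
    rw [← this]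
    simp only [stdNormalCDF, stdNormalPDF]
    ring
  rw [h]
  exact ((continuous_stdNormalPDF.integral_hasStrictDerivAt 0 z).hasDerivAt).const_add _

section Partials

variable {K Rd Rf x y : ℝ}

theorem hasDerivAt_log_div_const (hK : K ≠ 0) (hx : x ≠ 0) :
    HasDerivAt (fun x' => Real.log (x' / K)) x⁻¹ x := by
  refine HasDerivAt.congr_deriv (((hasDerivAt_id x).div_const K).log (div_ne_zero hx hK)) ?_
  simp only [id]
  field_simp

theorem hasDerivAt_dplus_left (hK : K ≠ 0) (hx : x ≠ 0) :
    HasDerivAt (fun x' => dplus K Rd Rf x' y) (1 / (x * Real.sqrt y)) x := by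
  refine HasDerivAt.congr_deriv (((((hasDerivAt_log_div_const hK hx).add_const Rd).sub_const Rf).div_const
    (Real.sqrt y)).add_const (Real.sqrt y / 2)) ?_
  rw [one_div, mul_inv, div_eq_mul_inv]

theorem hasDerivAt_dminus_left (hK : K ≠ 0) (hx : x ≠ 0) :
    HasDerivAt (fun x' => dminus K Rd Rf x' y) (1 / (x * Real.sqrt y)) x := by
  refine HasDerivAt.congr_deriv (((((hasDerivAt_log_div_const hK hx).add_const Rd).sub_const Rf).div_const
    (Real.sqrt y)).sub_const (Real.sqrt y / 2)) ?_
  rw [one_div, mul_inv, div_eq_mul_inv]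

theorem hasDerivAt_dplus_right (hy : 0 < y) :
    HasDerivAt (fun y' => dplus K Rd Rf x y') (-(dminus K Rd Rf x y / (2 * y))) y := by
  have hs : Real.sqrt y ≠ 0 := (Real.sqrt_pos.2 hy).ne'
  have h := Real.hasDerivAt_sqrt hy.ne'
  refine HasDerivAt.congr_deriv (((hasDerivAt_const y (Real.log (x / K) + Rd - Rf)).div h hs).add
    (h.div_const 2)) ?_
  simp only [dminus]
  obtain ⟨s, hs0, rfl⟩ : ∃ s, 0 < s ∧ y = s ^ 2 :=
    ⟨Real.sqrt y, Real.sqrt_pos.2 hy, (Real.sq_sqrt hy.le).symm⟩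
  rw [Real.sqrt_sq hs0.le]
  field_simp
  ring

theorem hasDerivAt_dminus_right (hy : 0 < y) :
    HasDerivAt (fun y' => dminus K Rd Rf x y') (-(dplus K Rd Rf x y / (2 * y))) y := by
  have hs : Real.sqrt y ≠ 0 := (Real.sqrt_pos.2 hy).ne'
  have h := Real.hasDerivAt_sqrt hy.ne'
  refine HasDerivAt.congr_deriv (((hasDerivAt_const y (Real.log (x / K) + Rd - Rf)).div h hs).sub
    (h.div_const 2)) ?_
  simp only [dplus]
  obtain ⟨s, hs0, rfl⟩ : ∃ s, 0 < s ∧ y = s ^ 2 :=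
    ⟨Real.sqrt y, Real.sqrt_pos.2 hy, (Real.sq_sqrt hy.le).symm⟩
  rw [Real.sqrt_sq hs0.le]
  field_simp
  ring

theorem dplus_sub_dminus : dplus K Rd Rf x y - dminus K Rd Rf x y = Real.sqrt y := by
  simp only [dplus, dminus]
  ring

theorem strike_mul_stdNormalPDF_dminus (hK : 0 < K) (hx : 0 < x) (hy : 0 < y) :
    K * Real.exp (-Rd) * stdNormalPDF (dminus K Rd Rf x y)
      = x * Real.exp (-Rf) * stdNormalPDF (dplus K Rd Rf x y) := by
  have hs : Real.sqrt y ≠ 0 := (Real.sqrt_pos.2 hy).ne'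
  have hsq : dplus K Rd Rf x y ^ 2 - dminus K Rd Rf x y ^ 2
      = 2 * (Real.log x - Real.log K + Rd - Rf) := by
    rw [← Real.log_div hx.ne' hK.ne']
    simp only [dplus, dminus]
    field_simp
    ring
  have he : Real.exp (Real.log K + -Rd + -dminus K Rd Rf x y ^ 2 / 2)
      = Real.exp (Real.log x + -Rf + -dplus K Rd Rf x y ^ 2 / 2) := by
    congr 1
    linarith
  simp only [Real.exp_add, Real.exp_log hK, Real.exp_log hx] at he
  simp only [stdNormalPDF]
  linear_combination (Real.sqrt (2 * Real.pi))⁻¹ * he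

theorem hasDerivAt_putBS_left (hK : 0 < K) (hx : 0 < x) (hy : 0 < y) :
    HasDerivAt (fun x' => PutBS K Rd Rf x' y)
      (-(Real.exp (-Rf) * stdNormalCDF (-(dplus K Rd Rf x y)))) x := by
  have hm := (hasDerivAt_stdNormalCDF _).comp x
    (hasDerivAt_dminus_left (Rd := Rd) (Rf := Rf) (y := y) hK.ne' hx.ne').neg
  have hp := (hasDerivAt_stdNormalCDF _).comp x
    (hasDerivAt_dplus_left (Rd := Rd) (Rf := Rf) (y := y) hK.ne' hx.ne').neg
  refine HasDerivAt.congr_deriv ((hm.const_mul (K * Real.exp (-Rd))).sub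
    (((hasDerivAt_id x).mul_const (Real.exp (-Rf))).mul hp)) ?_
  simp only [stdNormalPDF_neg, id, Pi.neg_apply]
  linear_combination (-(1 / (x * Real.sqrt y))) *
    strike_mul_stdNormalPDF_dminus (Rd := Rd) (Rf := Rf) hK hx hy

theorem hasDerivAt_putBS_right (hK : 0 < K) (hx : 0 < x) (hy : 0 < y) :
    HasDerivAt (fun y' => PutBS K Rd Rf x y')
      (x * Real.exp (-Rf) * (stdNormalPDF (dplus K Rd Rf x y) / (2 * Real.sqrt y))) y := by
  have hm := (hasDerivAt_stdNormalCDF _).comp y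
    (hasDerivAt_dminus_right (K := K) (Rd := Rd) (Rf := Rf) (x := x) hy).neg
  have hp := (hasDerivAt_stdNormalCDF _).comp y
    (hasDerivAt_dplus_right (K := K) (Rd := Rd) (Rf := Rf) (x := x) hy).neg
  refine HasDerivAt.congr_deriv ((hm.const_mul (K * Real.exp (-Rd))).sub
    (hp.const_mul (x * Real.exp (-Rf)))) ?_
  simp only [stdNormalPDF_neg, Pi.neg_apply, neg_neg]
  have hs : 1 / (2 * Real.sqrt y)
      = (dplus K Rd Rf x y - dminus K Rd Rf x y) / (2 * y) := by
    rw [dplus_sub_dminus, div_eq_div_iff (by positivity) (by positivity)]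
    linear_combination (-2) * Real.sq_sqrt hy.le
  linear_combination (-(x * Real.exp (-Rf))) * stdNormalPDF (dplus K Rd Rf x y) * hs
    + dplus K Rd Rf x y / (2 * y) *
      strike_mul_stdNormalPDF_dminus (Rd := Rd) (Rf := Rf) hK hx hy

end Partials

/-- Second-order partial derivatives of the Black–Scholes put value. -/
theorem putBS_second_order_partials (K Rd Rf : ℝ) (hK : 0 < K)
    (x y : ℝ) (hx : 0 < x) (hy : 0 < y) :
    iteratedDeriv 2 (fun x' => PutBS K Rd Rf x' y) x
        = Real.exp (-Rf) * stdNormalPDF (dplus K Rd Rf x y) / (x * Real.sqrt y) ∧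
      iteratedDeriv 2 (fun y' => PutBS K Rd Rf x y') y
        = x * Real.exp (-Rf) * stdNormalPDF (dplus K Rd Rf x y)
            * (dminus K Rd Rf x y * dplus K Rd Rf x y - 1) / (4 * Real.sqrt y ^ 3) ∧
      deriv (fun y' => deriv (fun x' => PutBS K Rd Rf x' y') x) y
        = -(Real.exp (-Rf) * stdNormalPDF (dplus K Rd Rf x y) * dminus K Rd Rf x y
            / (2 * y)) := by
  rw [iteratedDeriv_succ, iteratedDeriv_one, iteratedDeriv_succ, iteratedDeriv_one]
  have hs : 0 < Real.sqrt y := Real.sqrt_pos.2 hy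
  refine ⟨?_, ?_, ?_⟩
  · have he : deriv (fun x' => PutBS K Rd Rf x' y) =ᶠ[nhds x]
        fun x' => -(Real.exp (-Rf) * stdNormalCDF (-(dplus K Rd Rf x' y))) := by
      filter_upwards [lt_mem_nhds hx] with x' hx'
      exact (hasDerivAt_putBS_left hK hx' hy).deriv
    rw [he.deriv_eq]
    have h := (((hasDerivAt_stdNormalCDF _).comp x
      (hasDerivAt_dplus_left (Rd := Rd) (Rf := Rf) (y := y) hK.ne' hx.ne').neg).const_mul
        (Real.exp (-Rf))).neg
    refine h.deriv.trans ?_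
    simp only [Pi.neg_apply, stdNormalPDF_neg]
    ring
  · have he : deriv (fun y' => PutBS K Rd Rf x y') =ᶠ[nhds y] fun y' =>
        x * Real.exp (-Rf) * (stdNormalPDF (dplus K Rd Rf x y') / (2 * Real.sqrt y')) := by
      filter_upwards [lt_mem_nhds hy] with y' hy'
      exact (hasDerivAt_putBS_right hK hx hy').deriv
    rw [he.deriv_eq]
    have h := (((hasDerivAt_stdNormalPDF _).comp y
      (hasDerivAt_dplus_right (K := K) (Rd := Rd) (Rf := Rf) (x := x) hy)).div
        ((Real.hasDerivAt_sqrt hy.ne').const_mul 2) (by positivity)).const_mul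
          (x * Real.exp (-Rf))
    refine h.deriv.trans ?_
    simp only [Function.comp_apply]
    generalize dplus K Rd Rf x y = p, dminus K Rd Rf x y = m
    obtain ⟨s, hs0, rfl⟩ : ∃ s, 0 < s ∧ y = s ^ 2 :=
      ⟨Real.sqrt y, hs, (Real.sq_sqrt hy.le).symm⟩
    rw [Real.sqrt_sq hs0.le]
    field_simp
    ring
  · have he : (fun y' => deriv (fun x' => PutBS K Rd Rf x' y') x) =ᶠ[nhds y]
        fun y' => -(Real.exp (-Rf) * stdNormalCDF (-(dplus K Rd Rf x y'))) := by
      filter_upwards [lt_mem_nhds hy] with y' hy'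
      exact (hasDerivAt_putBS_left hK hx hy').deriv
    rw [he.deriv_eq]
    have h := (((hasDerivAt_stdNormalCDF _).comp y
      (hasDerivAt_dplus_right (K := K) (Rd := Rd) (Rf := Rf) (x := x) hy).neg).const_mul
        (Real.exp (-Rf))).neg
    refine h.deriv.trans ?_
    simp only [Pi.neg_apply, stdNormalPDF_neg]
    ring
end

section
/- Suppose k^{(1)}, k^{(2)}, l^{(1)}, l^{(2)} are piecewise constant on the partition with respective values k_i^{(1)}, k_i^{(2)}, l_i^{(1)}, l_i^{(2)} on [T_i, T_{i+1}). Then for every i ∈ {0, …, N−1}, the two-fold integral operator satisfies the recursion ω_{T_{i+1}}^{(k^{(2)},l^{(2)}),(k^{(1)},l^{(1)})} = ω_{T_i}^{(k^{(2)},l^{(2)}),(k^{(1)},l^{(1)})} + l_i^{(2)} · e_{T_i}^{(k^{(2)})} · φ_{T_i,T_{i+1}}^{(k^{(2)},0)} · ω_{T_i}^{(k^{(1)},l^{(1)})} + l_i^{(2)} l_i^{(1)} · e_{T_i}^{(k^{(2)},k^{(1)})} · φ_{T_i,T_{i+1}}^{(k^{(2)},0),(k^{(1)},0)}. -/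
open MeasureTheory

/-- The one-fold integral operator ω_t^{(k,l)} = ∫₀^t l(u) e^{∫₀^u k(z) dz} du. -/
noncomputable def omega1 (k l : ℝ → ℝ) (t : ℝ) : ℝ :=
  ∫ u in (0 : ℝ)..t, l u * Real.exp (∫ z in (0 : ℝ)..u, k z)

/-- γ_i(u) = (u − T_i)/ΔT_i. -/
noncomputable def gam (T : ℕ → ℝ) (i : ℕ) (u : ℝ) : ℝ :=
  (u - T i) / (T (i + 1) - T i)

/-- φ_{T_i,t}^{(k,p)} = ∫_{T_i}^t γ_i(u)^p e^{∫_{T_i}^u k(z) dz} du. -/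
noncomputable def phiOp1 (T : ℕ → ℝ) (i : ℕ) (k : ℝ → ℝ) (p : ℕ) (t : ℝ) : ℝ :=
  ∫ u in (T i)..t, gam T i u ^ p * Real.exp (∫ z in (T i)..u, k z)

/-- The two-fold integral operator ω_t^{(k₂,l₂),(k₁,l₁)}. -/
noncomputable def omega2 (k2 l2 k1 l1 : ℝ → ℝ) (t : ℝ) : ℝ :=
  ∫ u in (0 : ℝ)..t, l2 u * Real.exp (∫ z in (0 : ℝ)..u, k2 z) * omega1 k1 l1 u

/-- The two-fold operator φ_{T_i,t}^{(k₂,p₂),(k₁,p₁)}. -/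
noncomputable def phiOp2 (T : ℕ → ℝ) (i : ℕ) (k2 : ℝ → ℝ) (p2 : ℕ)
    (k1 : ℝ → ℝ) (p1 : ℕ) (t : ℝ) : ℝ :=
  ∫ u in (T i)..t, gam T i u ^ p2 * Real.exp (∫ z in (T i)..u, k2 z) * phiOp1 T i k1 p1 u

theorem intervalIntegrable_of_eqOn_Ico_const {f : ℝ → ℝ} {a b c : ℝ} (hab : a ≤ b)
    (hf : ∀ t ∈ Set.Ico a b, f t = c) : IntervalIntegrable f volume a b := by
  refine (intervalIntegrable_const (c := c)).congr_uIoo fun t ht => ?_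
  rw [Set.uIoo_of_le hab] at ht
  exact (hf t ⟨ht.1.le, ht.2⟩).symm

/-- Splitting off the last piece of the integral of a piecewise constant function times a
continuous one. -/
theorem integral_mul_eq_add_const_mul_integral {l g : ℝ → ℝ} {a b c t : ℝ} (ha : 0 ≤ a)
    (hl : IntervalIntegrable l volume 0 b) (hg : ContinuousOn g (Set.Icc 0 b))
    (hc : ∀ s ∈ Set.Ico a b, l s = c) (hat : a ≤ t) (htb : t ≤ b) :
    ∫ u in (0 : ℝ)..t, l u * g u = (∫ u in (0 : ℝ)..a, l u * g u) + c * ∫ u in a..t, g u := by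
  have hb : 0 ≤ b := ha.trans (hat.trans htb)
  have hlg : IntervalIntegrable (fun u => l u * g u) volume 0 b :=
    hl.mul_continuousOn (by rwa [Set.uIcc_of_le hb])
  have h1 : IntervalIntegrable (fun u => l u * g u) volume 0 a :=
    hlg.mono_set (by
      rw [Set.uIcc_of_le ha, Set.uIcc_of_le hb]
      exact Set.Icc_subset_Icc le_rfl (hat.trans htb))
  have h2 : IntervalIntegrable (fun u => l u * g u) volume a t :=
    hlg.mono_set (by
      rw [Set.uIcc_of_le hat, Set.uIcc_of_le hb]
      exact Set.Icc_subset_Icc ha htb)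
  rw [← intervalIntegral.integral_add_adjacent_intervals h1 h2,
    ← intervalIntegral.integral_const_mul]
  congr 1
  apply intervalIntegral.integral_congr_uIoo
  intro u hu
  rw [Set.uIoo_of_le hat] at hu
  simp only [hc u ⟨hu.1.le, hu.2.trans_le htb⟩]

theorem continuousOn_integral_Icc {k : ℝ → ℝ} {a b c : ℝ} (hc : c ∈ Set.Icc a b)
    (hk : IntervalIntegrable k volume a b) :
    ContinuousOn (fun u => ∫ z in c..u, k z) (Set.Icc a b) := by
  have hab : a ≤ b := hc.1.trans hc.2
  rw [← Set.uIcc_of_le hab] at hc ⊢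
  exact intervalIntegral.continuousOn_primitive_interval' hk hc

theorem continuousOn_omega1 {k l : ℝ → ℝ} {b : ℝ} (hb : 0 ≤ b)
    (hk : IntervalIntegrable k volume 0 b) (hl : IntervalIntegrable l volume 0 b) :
    ContinuousOn (omega1 k l) (Set.Icc 0 b) :=
  continuousOn_integral_Icc (Set.left_mem_Icc.2 hb) (hl.mul_continuousOn (by
    rw [Set.uIcc_of_le hb]
    exact (continuousOn_integral_Icc (Set.left_mem_Icc.2 hb) hk).rexp))

theorem exp_integral_eq_mul {k : ℝ → ℝ} {a b u : ℝ} (ha : 0 ≤ a)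
    (hk : IntervalIntegrable k volume 0 b) (hu : u ∈ Set.Icc a b) :
    Real.exp (∫ z in (0 : ℝ)..u, k z)
      = Real.exp (∫ z in (0 : ℝ)..a, k z) * Real.exp (∫ z in a..u, k z) := by
  have hb : 0 ≤ b := ha.trans (hu.1.trans hu.2)
  rw [← Real.exp_add, intervalIntegral.integral_add_adjacent_intervals]
  · refine hk.mono_set ?_
    rw [Set.uIcc_of_le ha, Set.uIcc_of_le hb]
    exact Set.Icc_subset_Icc le_rfl (hu.1.trans hu.2)
  · refine hk.mono_set ?_
    rw [Set.uIcc_of_le hu.1, Set.uIcc_of_le hb]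
    exact Set.Icc_subset_Icc ha hu.2

theorem omega1_eq_add_phiOp1 {k l : ℝ → ℝ} {T : ℕ → ℝ} {i : ℕ} {b c t : ℝ} (ha : 0 ≤ T i)
    (hk : IntervalIntegrable k volume 0 b) (hl : IntervalIntegrable l volume 0 b)
    (hc : ∀ s ∈ Set.Ico (T i) b, l s = c) (hat : T i ≤ t) (htb : t ≤ b) :
    omega1 k l t = omega1 k l (T i)
      + c * Real.exp (∫ z in (0 : ℝ)..(T i), k z) * phiOp1 T i k 0 t := by
  have hb : 0 ≤ b := ha.trans (hat.trans htb)
  simp only [omega1, phiOp1, pow_zero, one_mul]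
  rw [integral_mul_eq_add_const_mul_integral ha hl
    (continuousOn_integral_Icc (Set.left_mem_Icc.2 hb) hk).rexp hc hat htb, mul_assoc,
    ← intervalIntegral.integral_const_mul (Real.exp _)]
  congr 2
  apply intervalIntegral.integral_congr
  intro u hu
  rw [Set.uIcc_of_le hat] at hu
  exact exp_integral_eq_mul ha hk ⟨hu.1, hu.2.trans htb⟩

theorem omega2_eq_add_phiOp {k2 l2 k1 l1 : ℝ → ℝ} {T : ℕ → ℝ} {i : ℕ} {b c2 c1 t : ℝ}
    (ha : 0 ≤ T i)
    (hk2 : IntervalIntegrable k2 volume 0 b) (hl2 : IntervalIntegrable l2 volume 0 b)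
    (hk1 : IntervalIntegrable k1 volume 0 b) (hl1 : IntervalIntegrable l1 volume 0 b)
    (hc2 : ∀ s ∈ Set.Ico (T i) b, l2 s = c2) (hc1 : ∀ s ∈ Set.Ico (T i) b, l1 s = c1)
    (hat : T i ≤ t) (htb : t ≤ b) :
    omega2 k2 l2 k1 l1 t
      = omega2 k2 l2 k1 l1 (T i)
          + c2 * Real.exp (∫ z in (0 : ℝ)..(T i), k2 z) * phiOp1 T i k2 0 t * omega1 k1 l1 (T i)
          + c2 * c1 * Real.exp (∫ z in (0 : ℝ)..(T i), (k2 z + k1 z))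
              * phiOp2 T i k2 0 k1 0 t := by
  have hab : T i ≤ b := hat.trans htb
  have hb : 0 ≤ b := ha.trans hab
  have hsub : ∀ {f : ℝ → ℝ} {x y : ℝ}, 0 ≤ x → x ≤ y → y ≤ b →
      IntervalIntegrable f volume 0 b → IntervalIntegrable f volume x y := by
    intro f x y hx hxy hy hf
    refine hf.mono_set ?_
    rw [Set.uIcc_of_le hxy, Set.uIcc_of_le hb]
    exact Set.Icc_subset_Icc hx hy
  have hexp : ∀ {k : ℝ → ℝ}, IntervalIntegrable k volume 0 b →
      ContinuousOn (fun u => Real.exp (∫ z in (T i)..u, k z)) (Set.uIcc (T i) t) := by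
    intro k hk
    rw [Set.uIcc_of_le hat]
    exact (continuousOn_integral_Icc (Set.left_mem_Icc.2 hat) (hsub ha hat htb hk)).rexp
  have hphi : ContinuousOn (fun u => ∫ z in (T i)..u, Real.exp (∫ w in (T i)..z, k1 w))
      (Set.uIcc (T i) t) := by
    have := (hexp hk1).intervalIntegrable (μ := volume)
    rw [Set.uIcc_of_le hat]
    exact continuousOn_integral_Icc (Set.left_mem_Icc.2 hat) this
  rw [intervalIntegral.integral_add (hsub le_rfl ha hab hk2) (hsub le_rfl ha hab hk1),
    Real.exp_add]
  set E2 := Real.exp (∫ z in (0 : ℝ)..(T i), k2 z)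
  set E1 := Real.exp (∫ z in (0 : ℝ)..(T i), k1 z)
  have hcongr : (∫ u in (T i)..t, Real.exp (∫ z in (0 : ℝ)..u, k2 z) * omega1 k1 l1 u)
      = E2 * omega1 k1 l1 (T i) * (∫ u in (T i)..t, Real.exp (∫ z in (T i)..u, k2 z))
        + E2 * (c1 * E1) * ∫ u in (T i)..t, Real.exp (∫ z in (T i)..u, k2 z)
            * ∫ z in (T i)..u, Real.exp (∫ w in (T i)..z, k1 w) := by
    rw [← intervalIntegral.integral_const_mul, ← intervalIntegral.integral_const_mul,
      ← intervalIntegral.integral_add ((hexp hk2).intervalIntegrable.const_mul _)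
        (((hexp hk2).fun_mul hphi).intervalIntegrable.const_mul _)]
    apply intervalIntegral.integral_congr
    intro u hu
    rw [Set.uIcc_of_le hat] at hu
    have h1 := omega1_eq_add_phiOp1 ha hk1 hl1 hc1 hu.1 (hu.2.trans htb)
    simp only [phiOp1, pow_zero, one_mul] at h1
    simp only [h1, exp_integral_eq_mul ha hk2 ⟨hu.1, hu.2.trans htb⟩]
    ring
  have hmain := integral_mul_eq_add_const_mul_integral ha hl2
    ((continuousOn_integral_Icc (Set.left_mem_Icc.2 hb) hk2).rexp.fun_mul
      (continuousOn_omega1 hb hk1 hl1)) hc2 hat htb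
  rw [hcongr] at hmain
  simp only [omega2, phiOp2, phiOp1, pow_zero, one_mul, mul_assoc] at hmain ⊢
  rw [hmain]
  ring

/-- Recursion for the two-fold integral operator under piecewise-constant parameters. -/
theorem omega2_recursion (N : ℕ) (T : ℕ → ℝ) (hT0 : T 0 = 0)
    (hmono : ∀ m < N, T m < T (m + 1))
    (k2 l2 k1 l1 : ℝ → ℝ) (kv2 lv2 kv1 lv1 : ℕ → ℝ)
    (hk2 : ∀ m < N, ∀ t ∈ Set.Ico (T m) (T (m + 1)), k2 t = kv2 m)
    (hl2 : ∀ m < N, ∀ t ∈ Set.Ico (T m) (T (m + 1)), l2 t = lv2 m)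
    (hk1 : ∀ m < N, ∀ t ∈ Set.Ico (T m) (T (m + 1)), k1 t = kv1 m)
    (hl1 : ∀ m < N, ∀ t ∈ Set.Ico (T m) (T (m + 1)), l1 t = lv1 m) :
    ∀ i < N,
      omega2 k2 l2 k1 l1 (T (i + 1))
        = omega2 k2 l2 k1 l1 (T i)
            + lv2 i * Real.exp (∫ z in (0 : ℝ)..(T i), k2 z)
                * phiOp1 T i k2 0 (T (i + 1)) * omega1 k1 l1 (T i)
            + lv2 i * lv1 i * Real.exp (∫ z in (0 : ℝ)..(T i), (k2 z + k1 z))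
                * phiOp2 T i k2 0 k1 0 (T (i + 1)) := by
  intro i hi
  have hpos : ∀ m ≤ N, 0 ≤ T m := by
    intro m
    induction m with
    | zero => intro _; exact hT0.ge
    | succ m ih => intro hm; exact (ih (by omega)).trans (hmono m (by omega)).le
  have hint : ∀ {f : ℝ → ℝ} {v : ℕ → ℝ},
      (∀ m < N, ∀ t ∈ Set.Ico (T m) (T (m + 1)), f t = v m) →
      IntervalIntegrable f volume 0 (T (i + 1)) := by
    intro f v hf
    rw [← hT0]
    exact IntervalIntegrable.trans_iterate fun m hm =>
      intervalIntegrable_of_eqOn_Ico_const (hmono m (by omega)).le (hf m (by omega))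
  exact omega2_eq_add_phiOp (hpos i hi.le) (hint hk2) (hint hl2) (hint hk1) (hint hl1)
    (hl2 i hi) (hl1 i hi) (hmono i hi).le le_rfl
end

section
/- Let n ≥ 1 and suppose k^{(1)}, …, k^{(n)}, l^{(1)}, …, l^{(n)} are piecewise constant on the partition with respective values k_i^{(j)}, l_i^{(j)} on [T_i, T_{i+1}). Then for every i ∈ {0, …, N−1}, the n-fold integral operator satisfies ω_{T_{i+1}}^{(k^{(n)},l^{(n)}),…,(k^{(1)},l^{(1)})} = Σ_{m=1}^{n+1} ω_{T_i}^{(k^{(n−m+1)},l^{(n−m+1)}),…,(k^{(1)},l^{(1)})} · (Π_{j=0}^{m−2} l_i^{(n−j)}) · e_{T_i}^{(k^{(n)},…,k^{(n−m+2)})} · φ_{T_i,T_{i+1}}^{(k^{(n)},0),…,(k^{(n−m+2)},0)}, where by convention the m = 1 summand equals ω_{T_i}^{(k^{(n)},l^{(n)}),…,(k^{(1)},l^{(1)})} (empty product, e and φ factors equal to 1), and in the m = n+1 summand the ω-factor equals 1. -/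
open MeasureTheory

/-- The n-fold integral operator
ω_t^{(k^{(n)},l^{(n)}),…,(k^{(1)},l^{(1)})}, defined recursively; `omegaN k l 0 = 1`. -/
noncomputable def omegaN (k l : ℕ → ℝ → ℝ) : ℕ → ℝ → ℝ
  | 0 => fun _ => 1
  | j + 1 => fun t =>
      ∫ u in (0 : ℝ)..t,
        l (j + 1) u * Real.exp (∫ z in (0 : ℝ)..u, k (j + 1) z) * omegaN k l j u

/-- The n-fold operator φ_{T_i,t}^{(k^{(n)},p_n),…,(k^{(1)},p_1)}, defined recursively;
`phiOpN T i k p 0 = 1`. -/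
noncomputable def phiOpN (T : ℕ → ℝ) (i : ℕ) (k : ℕ → ℝ → ℝ) (p : ℕ → ℕ) : ℕ → ℝ → ℝ
  | 0 => fun _ => 1
  | j + 1 => fun t =>
      ∫ u in (T i)..t,
        gam T i u ^ p (j + 1) * Real.exp (∫ z in (T i)..u, k (j + 1) z)
          * phiOpN T i k p j u

open Set intervalIntegral in
/-- The primitive of an interval integrable function times a continuous function is continuous. -/
theorem continuousOn_primitive_mul {a b : ℝ} {f g : ℝ → ℝ}
    (hf : IntervalIntegrable f volume a b) (hg : ContinuousOn g (uIcc a b)) :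
    ContinuousOn (fun t => ∫ u in a..t, f u * g u) (uIcc a b) :=
  continuousOn_primitive_interval' (hf.mul_continuousOn hg) left_mem_uIcc

theorem IntervalIntegrable.continuousOn_exp_primitive {a b : ℝ} {f : ℝ → ℝ}
    (hf : IntervalIntegrable f volume a b) :
    ContinuousOn (fun u => Real.exp (∫ z in a..u, f z)) (Set.uIcc a b) := by
  have := continuousOn_primitive_mul hf (continuousOn_const (c := (1 : ℝ)))
  simp only [mul_one] at this
  exact this.rexp

theorem continuous_gam (T : ℕ → ℝ) (i : ℕ) : Continuous (gam T i) := by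
  unfold gam
  fun_prop

theorem continuousOn_phiOpN (T : ℕ → ℝ) (i : ℕ) (k : ℕ → ℝ → ℝ) (p : ℕ → ℕ) (b : ℝ) (n : ℕ)
    (hk : ∀ j, 1 ≤ j → j ≤ n → IntervalIntegrable (k j) volume (T i) b) :
    ContinuousOn (phiOpN T i k p n) (Set.uIcc (T i) b) := by
  induction n with
  | zero => exact continuousOn_const
  | succ n ih =>
    have hφ := ih fun j h1 h2 => hk j h1 (by omega)
    have he := (hk (n + 1) (by omega) le_rfl).continuousOn_exp_primitive
    have hg : ContinuousOn (fun u => gam T i u ^ p (n + 1)) (Set.uIcc (T i) b) :=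
      ((continuous_gam T i).pow _).continuousOn
    exact continuousOn_primitive_mul (hg.mul he).intervalIntegrable hφ

theorem continuousOn_omegaN (k l : ℕ → ℝ → ℝ) (b : ℝ) (n : ℕ)
    (hk : ∀ j, 1 ≤ j → j ≤ n → IntervalIntegrable (k j) volume 0 b)
    (hl : ∀ j, 1 ≤ j → j ≤ n → IntervalIntegrable (l j) volume 0 b) :
    ContinuousOn (omegaN k l n) (Set.uIcc 0 b) := by
  induction n with
  | zero => exact continuousOn_const
  | succ n ih =>
    have hω := ih (fun j h1 h2 => hk j h1 (by omega)) (fun j h1 h2 => hl j h1 (by omega))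
    have he := (hk (n + 1) (by omega) le_rfl).continuousOn_exp_primitive
    exact continuousOn_primitive_mul ((hl (n + 1) (by omega) le_rfl).mul_continuousOn he) hω

/-- A function that is constant on `[a, b)` is interval integrable on `[a, b]`. -/
theorem intervalIntegrable_of_eqOn_Ico {a b c : ℝ} (hab : a ≤ b) {f : ℝ → ℝ}
    (hf : ∀ t ∈ Set.Ico a b, f t = c) : IntervalIntegrable f volume a b := by
  rw [intervalIntegrable_iff_integrableOn_Ico_of_le hab]
  exact (integrableOn_const (C := c) (by simp)).congr_fun (fun t ht => (hf t ht).symm)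
    measurableSet_Ico

/-- The interval integral of a function only depends on its values on the half-open interval. -/
theorem integral_congr_Ico {a b : ℝ} (hab : a ≤ b) {f g : ℝ → ℝ}
    (h : ∀ t ∈ Set.Ico a b, f t = g t) : ∫ u in a..b, f u = ∫ u in a..b, g u := by
  rw [intervalIntegral.integral_of_le hab, intervalIntegral.integral_of_le hab,
    ← integral_Ico_eq_integral_Ioc, ← integral_Ico_eq_integral_Ioc]
  exact setIntegral_congr_fun measurableSet_Ico h

/-- If every `l j` is constant on `[T i, b)`, then the `n`-fold operator `omegaN` at `t ∈ [T i, b]`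
expands in the values of the lower operators at `T i`. -/
theorem omegaN_eq_sum_phiOpN (T : ℕ → ℝ) (i : ℕ) (b : ℝ) (ha : 0 ≤ T i) (hab : T i ≤ b)
    (k l : ℕ → ℝ → ℝ) (c : ℕ → ℝ) (n : ℕ)
    (hk : ∀ j, 1 ≤ j → j ≤ n → IntervalIntegrable (k j) volume 0 b)
    (hl : ∀ j, 1 ≤ j → j ≤ n → IntervalIntegrable (l j) volume 0 b)
    (hc : ∀ j, 1 ≤ j → j ≤ n → ∀ t ∈ Set.Ico (T i) b, l j t = c j) :
    ∀ t ∈ Set.Icc (T i) b, omegaN k l n t = ∑ q ∈ Finset.range (n + 1),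
      omegaN k l q (T i) * (∏ j ∈ Finset.Icc (q + 1) n, c j * Real.exp (∫ z in 0..T i, k j z))
        * phiOpN T i (fun j => k (j + q)) (fun _ => 0) (n - q) t := by
  induction n with
  | zero =>
    intro t _
    simp [omegaN, phiOpN]
  | succ n ih =>
    intro t ht
    have ih' := ih (fun j h1 h2 => hk j h1 (by omega)) (fun j h1 h2 => hl j h1 (by omega))
      (fun j h1 h2 => hc j h1 (by omega))
    have hsub {x y : ℝ} (hx : 0 ≤ x) (hxy : x ≤ y) (hy : y ≤ b) : Set.uIcc x y ⊆ Set.uIcc 0 b := by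
      rw [Set.uIcc_of_le hxy, Set.uIcc_of_le (ha.trans hab)]
      exact Set.Icc_subset_Icc hx hy
    have hk1 := hk (n + 1) (by omega) le_rfl
    have hint : IntervalIntegrable (fun u => l (n + 1) u * Real.exp (∫ z in (0 : ℝ)..u, k (n + 1) z)
        * omegaN k l n u) volume 0 b :=
      ((hl (n + 1) (by omega) le_rfl).mul_continuousOn
        hk1.continuousOn_exp_primitive).mul_continuousOn
        (continuousOn_omegaN k l b n (fun j h1 h2 => hk j h1 (by omega))
          (fun j h1 h2 => hl j h1 (by omega)))
    have hsplit : omegaN k l (n + 1) t = omegaN k l (n + 1) (T i) +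
        ∫ u in T i..t, l (n + 1) u * Real.exp (∫ z in (0 : ℝ)..u, k (n + 1) z) * omegaN k l n u :=
      (intervalIntegral.integral_add_adjacent_intervals
        (hint.mono_set (hsub le_rfl ha hab))
        (hint.mono_set (hsub ha ht.1 ht.2))).symm
    have hcongr : ∀ u ∈ Set.Ico (T i) t,
        l (n + 1) u * Real.exp (∫ z in (0 : ℝ)..u, k (n + 1) z) * omegaN k l n u =
        ∑ q ∈ Finset.range (n + 1), omegaN k l q (T i)
          * (∏ j ∈ Finset.Icc (q + 1) (n + 1), c j * Real.exp (∫ z in 0..T i, k j z))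
          * (Real.exp (∫ z in T i..u, k (n + 1) z)
            * phiOpN T i (fun j => k (j + q)) (fun _ => 0) (n - q) u) := by
      intro u hu
      rw [hc (n + 1) (by omega) le_rfl u ⟨hu.1, hu.2.trans_le ht.2⟩,
        ih' u ⟨hu.1, hu.2.le.trans ht.2⟩,
        ← intervalIntegral.integral_add_adjacent_intervals
          (hk1.mono_set (hsub le_rfl ha hab))
          (hk1.mono_set (hsub ha hu.1 (hu.2.le.trans ht.2))), Real.exp_add, Finset.mul_sum]
      refine Finset.sum_congr rfl fun q hq => ?_
      rw [Finset.mem_range] at hq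
      rw [Finset.prod_Icc_succ_top (by omega)]
      ring
    rw [hsplit, integral_congr_Ico ht.1 hcongr, intervalIntegral.integral_finsetSum,
      Finset.sum_range_succ _ (n + 1), add_comm]
    · congr 1
      · refine Finset.sum_congr rfl fun q hq => ?_
        rw [Finset.mem_range] at hq
        rw [intervalIntegral.integral_const_mul, show n + 1 - q = n - q + 1 by omega]
        simp only [phiOpN, pow_zero, one_mul, show n - q + 1 + q = n + 1 by omega]
      · simp [phiOpN]
    · intro q hq
      rw [Finset.mem_range] at hq
      have hki : ∀ j, 1 ≤ j → j ≤ n + 1 → IntervalIntegrable (k j) volume (T i) t :=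
        fun j h1 h2 => (hk j h1 h2).mono_set (hsub ha ht.1 ht.2)
      exact ((hki (n + 1) (by omega) le_rfl).continuousOn_exp_primitive.mul
        (continuousOn_phiOpN T i _ _ t _ fun j h1 h2 =>
          hki (j + q) (by omega) (by omega))).intervalIntegrable.const_mul _

/-- General recursion for the n-fold integral operator under piecewise-constant parameters. -/
theorem omegaN_recursion (N : ℕ) (T : ℕ → ℝ) (hT0 : T 0 = 0)
    (hmono : ∀ m < N, T m < T (m + 1))
    (n : ℕ) (hn : 1 ≤ n)
    (k l : ℕ → ℝ → ℝ) (kv lv : ℕ → ℕ → ℝ)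
    (hk : ∀ j, 1 ≤ j → j ≤ n → ∀ m < N, ∀ t ∈ Set.Ico (T m) (T (m + 1)), k j t = kv j m)
    (hl : ∀ j, 1 ≤ j → j ≤ n → ∀ m < N, ∀ t ∈ Set.Ico (T m) (T (m + 1)), l j t = lv j m) :
    ∀ i < N,
      omegaN k l n (T (i + 1))
        = ∑ m ∈ Finset.Icc 1 (n + 1),
            omegaN k l (n + 1 - m) (T i)
              * (∏ j ∈ Finset.range (m - 1), lv (n - j) i)
              * Real.exp (∫ z in (0 : ℝ)..(T i), ∑ j ∈ Finset.Icc (n + 2 - m) n, k j z)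
              * phiOpN T i (fun j => k (j + (n + 1 - m))) (fun _ => 0) (m - 1)
                  (T (i + 1)) := by
  intro i hi
  have hmono' : ∀ m ≤ N, 0 ≤ T m := by
    intro m
    induction m with
    | zero => simp [hT0]
    | succ m ih => exact fun h => (ih (by omega)).trans (hmono m (by omega)).le
  have hint : ∀ (f : ℝ → ℝ) (v : ℕ → ℝ),
      (∀ m < N, ∀ t ∈ Set.Ico (T m) (T (m + 1)), f t = v m) →
        ∀ m ≤ N, IntervalIntegrable f volume 0 (T m) := by
    intro f v hf m hm
    rw [← hT0]
    exact IntervalIntegrable.trans_iterate fun j hj =>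
      intervalIntegrable_of_eqOn_Ico (hmono j (by omega)).le (hf j (by omega))
  have hab := (hmono i hi).le
  rw [omegaN_eq_sum_phiOpN T i (T (i + 1)) (hmono' i hi.le) hab k l (fun j => lv j i) n
    (fun j h1 h2 => hint _ (kv j) (hk j h1 h2) (i + 1) hi)
    (fun j h1 h2 => hint _ (lv j) (hl j h1 h2) (i + 1) hi)
    (fun j h1 h2 => hl j h1 h2 i hi) _ ⟨hab, le_rfl⟩]
  refine Finset.sum_nbij' (fun q => n + 1 - q) (fun m => n + 1 - m) ?_ ?_ ?_ ?_ ?_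
  any_goals (simp only [Finset.mem_range, Finset.mem_Icc]; omega)
  intro q hq
  rw [Finset.mem_range] at hq
  rw [show n + 1 - (n + 1 - q) = q by omega, show n + 1 - q - 1 = n - q by omega,
    show n + 2 - (n + 1 - q) = q + 1 by omega, Finset.prod_mul_distrib, ← Real.exp_sum,
    intervalIntegral.integral_finsetSum]
  · have hprod : ∏ j ∈ Finset.Icc (q + 1) n, lv j i = ∏ j ∈ Finset.range (n - q), lv (n - j) i := by
      refine Finset.prod_nbij' (fun j => n - j) (fun j => n - j) ?_ ?_ ?_ ?_ ?_
      any_goals (simp only [Finset.mem_range, Finset.mem_Icc]; omega)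
      intro j hj
      rw [Finset.mem_Icc] at hj
      rw [show n - (n - j) = j by omega]
    rw [hprod]
    ring
  · intro j hj
    rw [Finset.mem_Icc] at hj
    exact hint _ (kv j) (hk j (by omega) hj.2) i hi.le
end

section
/- Let n ≥ 2 and suppose k^{(1)}, …, k^{(n)} are piecewise constant on the partition with values k_i^{(j)} on [T_i, T_{i+1}). Then for every t ∈ (T_i, T_{i+1}] and p₁, …, p_n ∈ ℕ ∪ {0}, the n-fold φ operator satisfies: (a) if k_i^{(n)} ≠ 0 and p_n ≥ 1, then φ_{T_i,t}^{(k^{(n)},p_n),…,(k^{(1)},p_1)} = (1/k_i^{(n)})·(γ_i(t)^{p_n} e^{k_i^{(n)} ΔT_i γ_i(t)} φ_{T_i,t}^{(k^{(n−1)},p_{n−1}),…,(k^{(1)},p_1)} − (p_n/ΔT_i)·φ_{T_i,t}^{(k^{(n)},p_n−1),(k^{(n−1)},p_{n−1}),…,(k^{(1)},p_1)} − φ_{T_i,t}^{(k^{(n)}+k^{(n−1)}, p_n+p_{n−1}),(k^{(n−2)},p_{n−2}),…,(k^{(1)},p_1)}); (b) if k_i^{(n)} ≠ 0 and p_n = 0,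 then φ_{T_i,t}^{(k^{(n)},0),…,(k^{(1)},p_1)} = (1/k_i^{(n)})·(e^{k_i^{(n)} ΔT_i γ_i(t)} φ_{T_i,t}^{(k^{(n−1)},p_{n−1}),…,(k^{(1)},p_1)} − φ_{T_i,t}^{(k^{(n)}+k^{(n−1)}, p_{n−1}),(k^{(n−2)},p_{n−2}),…,(k^{(1)},p_1)}); (c) if k_i^{(n)} = 0 and p_n ≥ 0, then φ_{T_i,t}^{(k^{(n)},p_n),…,(k^{(1)},p_1)} = (ΔT_i/(p_n+1))·(γ_i(t)^{p_n+1} φ_{T_i,t}^{(k^{(n−1)},p_{n−1}),…,(k^{(1)},p_1)} − φ_{T_i,t}^{(k^{(n−1)}, p_n+p_{n−1}+1),(k^{(n−2)},p_{n−2}),…,(k^{(1)},p_1)}). -/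
open MeasureTheory

/-- On `[T_i, T_{i+1}]` the operator only sees the coefficients on `[T_i, T_{i+1})`. -/
theorem phiOpN_congr {T : ℕ → ℝ} {i : ℕ} {k k' : ℕ → ℝ → ℝ} {p p' : ℕ → ℕ} {m : ℕ}
    (hk : ∀ j, 1 ≤ j → j ≤ m → Set.EqOn (k j) (k' j) (Set.Ico (T i) (T (i + 1))))
    (hp : ∀ j, 1 ≤ j → j ≤ m → p j = p' j) :
    Set.EqOn (phiOpN T i k p m) (phiOpN T i k' p' m) (Set.Icc (T i) (T (i + 1))) := by
  induction m with
  | zero => intro t _; rfl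
  | succ m ih =>
    intro t ht
    have hm := ih (fun j h1 h2 => hk j h1 (by omega)) (fun j h1 h2 => hp j h1 (by omega))
    refine intervalIntegral.integral_congr fun u hu => ?_
    rw [Set.uIcc_of_le ht.1] at hu
    have hint : ∫ z in (T i)..u, k (m + 1) z = ∫ z in (T i)..u, k' (m + 1) z := by
      refine intervalIntegral.integral_congr_Ioo_of_le hu.1 fun z hz => ?_
      exact hk (m + 1) (by omega) le_rfl ⟨hz.1.le, hz.2.trans_le (hu.2.trans ht.2)⟩
    simp only [hint, hp (m + 1) (by omega) le_rfl, hm ⟨hu.1, hu.2.trans ht.2⟩]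

theorem hasDerivAt_gam (T : ℕ → ℝ) (i : ℕ) (u : ℝ) :
    HasDerivAt (gam T i) (1 / (T (i + 1) - T i)) u :=
  ((hasDerivAt_id u).sub_const (T i)).div_const _

/-- The operator with constant coefficients `c j`. -/
theorem phiOpN_const_succ (T : ℕ → ℝ) (i : ℕ) (c : ℕ → ℝ) (p : ℕ → ℕ) (m : ℕ) (t : ℝ) :
    phiOpN T i (fun j _ => c j) p (m + 1) t =
      ∫ u in (T i)..t, gam T i u ^ p (m + 1) * Real.exp (c (m + 1) * (u - T i))
        * phiOpN T i (fun j _ => c j) p m u := by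
  simp only [phiOpN, intervalIntegral.integral_const, smul_eq_mul, mul_comm (c (m + 1))]

theorem continuous_phiOpN_const (T : ℕ → ℝ) (i : ℕ) (c : ℕ → ℝ) (p : ℕ → ℕ) (m : ℕ) :
    Continuous (phiOpN T i (fun j _ => c j) p m) := by
  induction m with
  | zero => exact continuous_const
  | succ m ih =>
    have hg := continuous_gam T i
    rw [funext (phiOpN_const_succ T i c p m)]
    exact intervalIntegral.continuous_primitive
      (fun a b => Continuous.intervalIntegrable (by fun_prop) a b) _

theorem hasDerivAt_phiOpN_const (T : ℕ → ℝ) (i : ℕ) (c : ℕ → ℝ) (p : ℕ → ℕ) (m : ℕ) (t : ℝ) :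
    HasDerivAt (phiOpN T i (fun j _ => c j) p (m + 1))
      (gam T i t ^ p (m + 1) * Real.exp (c (m + 1) * (t - T i))
        * phiOpN T i (fun j _ => c j) p m t) t := by
  have hg := continuous_gam T i
  have hφ := continuous_phiOpN_const T i c p m
  have hc : Continuous fun u => gam T i u ^ p (m + 1) * Real.exp (c (m + 1) * (u - T i))
        * phiOpN T i (fun j _ => c j) p m u := by fun_prop
  rw [funext (phiOpN_const_succ T i c p m)]
  exact (hc.integral_hasStrictDerivAt (T i) t).hasDerivAt

/-- Integration by parts against the operator with constant coefficients. -/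
theorem integral_deriv_mul_phiOpN_const (T : ℕ → ℝ) (i : ℕ) (c : ℕ → ℝ) (p : ℕ → ℕ) (m : ℕ)
    (t : ℝ) {f f' : ℝ → ℝ} (hf : ∀ u, HasDerivAt f (f' u) u) (hf' : Continuous f') :
    ∫ u in (T i)..t, f' u * phiOpN T i (fun j _ => c j) p (m + 1) u =
      f t * phiOpN T i (fun j _ => c j) p (m + 1) t -
        ∫ u in (T i)..t, f u * (gam T i u ^ p (m + 1) * Real.exp (c (m + 1) * (u - T i))
          * phiOpN T i (fun j _ => c j) p m u) := by
  have hg := continuous_gam T i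
  have hφ := continuous_phiOpN_const T i c p m
  have hφ' : Continuous fun u => gam T i u ^ p (m + 1) * Real.exp (c (m + 1) * (u - T i))
        * phiOpN T i (fun j _ => c j) p m u := by fun_prop
  have h0 : phiOpN T i (fun j _ => c j) p (m + 1) (T i) = 0 := by simp [phiOpN]
  have h := intervalIntegral.integral_mul_deriv_eq_deriv_mul (a := T i) (b := t)
    (fun u _ => hf u) (fun u _ => hasDerivAt_phiOpN_const T i c p m u)
    (hf'.intervalIntegrable _ _) (hφ'.intervalIntegrable _ _)
  rw [h0] at h
  linarith

/-- The recursion for a nonzero leading coefficient, before dividing by it. -/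
theorem mul_phiOpN_const (T : ℕ → ℝ) (i : ℕ) (c : ℕ → ℝ) (p : ℕ → ℕ) (m : ℕ) (t : ℝ) :
    c (m + 2) * phiOpN T i (fun j _ => c j) p (m + 2) t =
      gam T i t ^ p (m + 2) * Real.exp (c (m + 2) * (t - T i))
          * phiOpN T i (fun j _ => c j) p (m + 1) t
        - (p (m + 2) : ℝ) / (T (i + 1) - T i)
          * (∫ u in (T i)..t, gam T i u ^ (p (m + 2) - 1) * Real.exp (c (m + 2) * (u - T i))
              * phiOpN T i (fun j _ => c j) p (m + 1) u)
        - ∫ u in (T i)..t, gam T i u ^ (p (m + 2) + p (m + 1))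
            * Real.exp ((c (m + 2) + c (m + 1)) * (u - T i))
            * phiOpN T i (fun j _ => c j) p m u := by
  have hg := continuous_gam T i
  have hφ := continuous_phiOpN_const T i c p (m + 1)
  have hexp (u : ℝ) : HasDerivAt (fun u => Real.exp (c (m + 2) * (u - T i)))
      (Real.exp (c (m + 2) * (u - T i)) * c (m + 2)) u := by
    simpa using (((hasDerivAt_id u).sub_const (T i)).const_mul (c (m + 2))).exp
  have h := integral_deriv_mul_phiOpN_const T i c p m t
    (fun u => ((hasDerivAt_gam T i u).pow (p (m + 2))).mul (hexp u)) (by fun_prop)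
  have hsplit : ∀ u, c (m + 2) * (gam T i u ^ p (m + 2) * Real.exp (c (m + 2) * (u - T i))
        * phiOpN T i (fun j _ => c j) p (m + 1) u)
      + (p (m + 2) : ℝ) / (T (i + 1) - T i)
        * (gam T i u ^ (p (m + 2) - 1) * Real.exp (c (m + 2) * (u - T i))
          * phiOpN T i (fun j _ => c j) p (m + 1) u)
      = ((p (m + 2) : ℝ) * gam T i u ^ (p (m + 2) - 1) * (1 / (T (i + 1) - T i))
          * Real.exp (c (m + 2) * (u - T i))
        + gam T i u ^ p (m + 2) * (Real.exp (c (m + 2) * (u - T i)) * c (m + 2)))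
        * phiOpN T i (fun j _ => c j) p (m + 1) u := fun u => by ring
  have hmerge : ∀ u, gam T i u ^ (p (m + 2) + p (m + 1))
        * Real.exp ((c (m + 2) + c (m + 1)) * (u - T i)) * phiOpN T i (fun j _ => c j) p m u
      = gam T i u ^ p (m + 2) * Real.exp (c (m + 2) * (u - T i))
        * (gam T i u ^ p (m + 1) * Real.exp (c (m + 1) * (u - T i))
          * phiOpN T i (fun j _ => c j) p m u) := fun u => by
    rw [pow_add, add_mul, Real.exp_add]; ring
  rw [phiOpN_const_succ T i c p (m + 1), ← intervalIntegral.integral_const_mul,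
    ← intervalIntegral.integral_const_mul]
  simp only [hmerge]
  rw [eq_sub_iff_add_eq, eq_sub_iff_add_eq, add_right_comm,
    ← intervalIntegral.integral_add (Continuous.intervalIntegrable (by fun_prop) _ _)
      (Continuous.intervalIntegrable (by fun_prop) _ _)]
  simp only [hsplit]
  exact eq_sub_iff_add_eq.mp h

/-- The recursion for a vanishing leading coefficient. -/
theorem phiOpN_const_of_eq_zero (T : ℕ → ℝ) (i : ℕ) (hT : T i < T (i + 1)) (c : ℕ → ℝ)
    (p : ℕ → ℕ) (m : ℕ) (hc : c (m + 2) = 0) (t : ℝ) :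
    phiOpN T i (fun j _ => c j) p (m + 2) t =
      (T (i + 1) - T i) / (p (m + 2) + 1)
        * (gam T i t ^ (p (m + 2) + 1) * phiOpN T i (fun j _ => c j) p (m + 1) t
          - ∫ u in (T i)..t, gam T i u ^ (p (m + 2) + p (m + 1) + 1)
              * Real.exp (c (m + 1) * (u - T i)) * phiOpN T i (fun j _ => c j) p m u) := by
  have hg := continuous_gam T i
  have hΔ : T (i + 1) - T i ≠ 0 := (sub_pos.mpr hT).ne'
  have hp : (p (m + 2) : ℝ) + 1 ≠ 0 := by positivity
  have h := integral_deriv_mul_phiOpN_const T i c p m t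
    (fun u => (hasDerivAt_gam T i u).pow (p (m + 2) + 1)) (by fun_prop)
  have hmerge : ∀ u, gam T i u ^ (p (m + 2) + p (m + 1) + 1)
        * Real.exp (c (m + 1) * (u - T i)) * phiOpN T i (fun j _ => c j) p m u
      = gam T i u ^ (p (m + 2) + 1) * (gam T i u ^ p (m + 1) * Real.exp (c (m + 1) * (u - T i))
          * phiOpN T i (fun j _ => c j) p m u) := fun u => by ring
  simp only [hmerge]
  refine Eq.trans ?_ (congrArg _ h)
  rw [phiOpN_const_succ T i c p (m + 1), ← intervalIntegral.integral_const_mul]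
  refine intervalIntegral.integral_congr fun u _ => ?_
  simp only [hc, zero_mul, Real.exp_zero, Nat.add_sub_cancel, Nat.cast_add, Nat.cast_one]
  field_simp

/-- Explicit recursion for the n-fold φ operator under piecewise-constant parameters. -/
theorem phiOpN_recursion (N : ℕ) (T : ℕ → ℝ) (hT0 : T 0 = 0)
    (hmono : ∀ m < N, T m < T (m + 1))
    (n : ℕ) (hn : 2 ≤ n)
    (k : ℕ → ℝ → ℝ) (kv : ℕ → ℕ → ℝ)
    (hk : ∀ j, 1 ≤ j → j ≤ n → ∀ m < N, ∀ t ∈ Set.Ico (T m) (T (m + 1)), k j t = kv j m)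
    (p : ℕ → ℕ) :
    ∀ i < N, ∀ t ∈ Set.Ioc (T i) (T (i + 1)),
      (kv n i ≠ 0 → 1 ≤ p n →
        phiOpN T i k p n t
          = (1 / kv n i)
              * (gam T i t ^ p n * Real.exp (kv n i * (T (i + 1) - T i) * gam T i t)
                    * phiOpN T i k p (n - 1) t
                - ((p n : ℝ) / (T (i + 1) - T i))
                    * phiOpN T i k (Function.update p n (p n - 1)) n t
                - phiOpN T i
                    (fun j => if j = n - 1 then fun z => k n z + k (n - 1) z else k j)
                    (fun j => if j = n - 1 then p n + p (n - 1) else p j)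
                    (n - 1) t)) ∧
      (kv n i ≠ 0 → p n = 0 →
        phiOpN T i k p n t
          = (1 / kv n i)
              * (Real.exp (kv n i * (T (i + 1) - T i) * gam T i t)
                    * phiOpN T i k p (n - 1) t
                - phiOpN T i
                    (fun j => if j = n - 1 then fun z => k n z + k (n - 1) z else k j)
                    (fun j => if j = n - 1 then p (n - 1) else p j)
                    (n - 1) t)) ∧
      (kv n i = 0 →
        phiOpN T i k p n t
          = ((T (i + 1) - T i) / (p n + 1))
              * (gam T i t ^ (p n + 1) * phiOpN T i k p (n - 1) t
                - phiOpN T i k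
                    (fun j => if j = n - 1 then p n + p (n - 1) + 1 else p j)
                    (n - 1) t)) := by
  intro i hi t ht
  obtain ⟨m, rfl⟩ : ∃ m, n = m + 2 := ⟨n - 2, by omega⟩
  have hT := hmono i hi
  have hΔ : T (i + 1) - T i ≠ 0 := (sub_pos.mpr hT).ne'
  have htI : t ∈ Set.Icc (T i) (T (i + 1)) := ⟨ht.1.le, ht.2⟩
  set c : ℕ → ℝ := fun j => kv j i with hc
  have hconst (q : ℕ → ℕ) (r : ℕ) (hr : r ≤ m + 2) :
      phiOpN T i k q r t = phiOpN T i (fun j _ => c j) q r t :=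
    phiOpN_congr (fun j h1 h2 z hz => hk j h1 (h2.trans hr) i hi z hz) (fun _ _ _ => rfl) htI
  have hlower (k' : ℕ → ℝ → ℝ) (q : ℕ → ℕ) (r : ℕ) (d : ℝ)
      (hk' : ∀ j, 1 ≤ j → j ≤ r → ∀ z ∈ Set.Ico (T i) (T (i + 1)), k' j z = c j)
      (hd : ∀ z ∈ Set.Ico (T i) (T (i + 1)), k' (r + 1) z = d)
      (hq : ∀ j, 1 ≤ j → j ≤ r → q j = p j) :
      phiOpN T i k' q (r + 1) t =
        ∫ u in (T i)..t, gam T i u ^ q (r + 1) * Real.exp (d * (u - T i))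
          * phiOpN T i (fun j _ => c j) p r u := by
    have h := phiOpN_congr (T := T) (i := i) (k := k') (p := q) (p' := q) (m := r + 1)
      (k' := fun j _ => Function.update c (r + 1) d j) (fun j h1 h2 z hz => by
        rcases h2.lt_or_eq with h | rfl
        · simp only [Function.update_of_ne h.ne, hk' j h1 (by omega) z hz]
        · simp only [Function.update_self, hd z hz]) (fun _ _ _ => rfl) htI
    rw [h, phiOpN_const_succ]
    refine intervalIntegral.integral_congr fun u hu => ?_
    rw [Set.uIcc_of_le ht.1.le] at hu
    have h' := phiOpN_congr (T := T) (i := i) (k := fun j _ => Function.update c (r + 1) d j)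
      (k' := fun j _ => c j) (p := q) (p' := p) (m := r)
      (fun j _ h2 z _ => by
        simp only [Function.update_of_ne (show j ≠ r + 1 by omega)]) hq
      ⟨hu.1, hu.2.trans ht.2⟩
    simp only [h', Function.update_self]
  have hexp : kv (m + 2) i * (T (i + 1) - T i) * gam T i t = c (m + 2) * (t - T i) := by
    simp only [gam, hc]
    field_simp
  have hpred : m + 2 - 1 = m + 1 := rfl
  have hkc (j : ℕ) (h1 : 1 ≤ j) (h2 : j ≤ m + 2) :
      ∀ z ∈ Set.Ico (T i) (T (i + 1)), k j z = c j := fun z hz => hk j h1 h2 i hi z hz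
  have hmul := mul_phiOpN_const T i c p m t
  rw [hpred, hconst p (m + 2) le_rfl, hconst p (m + 1) (by omega), hexp]
  have hsum (q : ℕ) : phiOpN T i
      (fun j => if j = m + 1 then fun z => k (m + 2) z + k (m + 1) z else k j)
      (fun j => if j = m + 1 then q else p j) (m + 1) t =
        ∫ u in (T i)..t, gam T i u ^ q * Real.exp ((c (m + 2) + c (m + 1)) * (u - T i))
            * phiOpN T i (fun j _ => c j) p m u := by
    rw [hlower _ _ m (c (m + 2) + c (m + 1))]
    · simp only [if_true]
    · intro j h1 h2 z hz
      rw [if_neg (by omega), hkc j h1 (by omega) z hz]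
    · intro z hz
      simp only [if_true]
      rw [hkc _ (by omega) le_rfl z hz, hkc _ (by omega) (by omega) z hz]
    · intro j _ h2
      rw [if_neg (by omega)]
  refine ⟨fun h0 _ => ?_, fun h0 hp => ?_, fun h0 => ?_⟩
  · rw [hsum, hlower k (Function.update p (m + 2) (p (m + 2) - 1)) (m + 1) (c (m + 2))
      (fun j h1 h2 => hkc j h1 (by omega)) (hkc _ (by omega) le_rfl)
      (fun j _ h2 => Function.update_of_ne (by omega) _ _), Function.update_self, ← hmul]
    simp only [hc]
    field_simp
  · rw [hp] at hmul
    simp only [pow_zero, one_mul, Nat.cast_zero, zero_div, zero_mul, sub_zero, zero_add] at hmul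
    rw [hsum, ← hmul]
    simp only [hc]
    field_simp
  · rw [hlower k _ m (c (m + 1)) (fun j h1 h2 => hkc j h1 (by omega))
      (hkc _ (by omega) (by omega)) (fun j _ h2 => if_neg (by omega)), if_pos rfl]
    exact phiOpN_const_of_eq_zero T i hT c p m h0 t
end
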